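/- Let Ω ⊂ ℝⁿ be a bounded open set, let f : Ω × ℝ × ℝⁿ → ℝ be measurable, and let g be a bounded Lipschitz function on Ω. If u₁, u₂ ∈ A_sub(g,Ω), i.e. each is a minimizer of F(·,Ω) over W_g^{1,∞}(Ω) and an absolute subminimizer of F on Ω, then u = max(u₁, u₂) belongs to A_sub(g,Ω). (Lemma 3.1(i).) -/

import Mathlib

open MeasureTheory Filter Set

/-- The supremal functional `F(u,V) = ess sup_{x ∈ V} f(x, u(x), Du(x))`, valued in `EReal`. -/
noncomputable def suprF {n : ℕ} (f : EuclideanSpace ℝ (Fin n) → ℝ → EuclideanSpace ℝ (Fin n) → ℝ)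
    (u : EuclideanSpace ℝ (Fin n) → ℝ) (V : Set (EuclideanSpace ℝ (Fin n))) : EReal :=
  essSup (fun x => ((f x (u x) (gradient u x) : ℝ) : EReal)) (volume.restrict V)

/-- Hypothesis (H1): lower semicontinuity in `(s,p)` for a.e. `x ∈ Ω`, and
quasiconvexity (level-convexity) of `p ↦ f x s p` for all `(x,s)`. -/
def H1 {n : ℕ} (Ω : Set (EuclideanSpace ℝ (Fin n)))
    (f : EuclideanSpace ℝ (Fin n) → ℝ → EuclideanSpace ℝ (Fin n) → ℝ) : Prop :=
  (∀ᵐ x ∂(volume.restrict Ω),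
      LowerSemicontinuous (fun sp : ℝ × EuclideanSpace ℝ (Fin n) => f x sp.1 sp.2)) ∧
  (∀ x ∈ Ω, ∀ s : ℝ, ∀ p q : EuclideanSpace ℝ (Fin n), ∀ t : ℝ, 0 ≤ t → t ≤ 1 →
      f x s (t • p + (1 - t) • q) ≤ max (f x s p) (f x s q))

/-- Hypothesis (H2): uniform coercivity. -/
def H2 {n : ℕ} (Ω : Set (EuclideanSpace ℝ (Fin n)))
    (f : EuclideanSpace ℝ (Fin n) → ℝ → EuclideanSpace ℝ (Fin n) → ℝ) : Prop :=
  ∀ c : ℝ, ∃ R : ℝ, 0 ≤ R ∧ ∀ x ∈ Ω, ∀ s : ℝ, ∀ p : EuclideanSpace ℝ (Fin n),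
    f x s p ≤ c → ‖p‖ ≤ R

/-- `u` is a bounded Lipschitz function on `V` (i.e. `u ∈ W^{1,∞}(V)`). -/
def BddLipschitzOn {n : ℕ} (u : EuclideanSpace ℝ (Fin n) → ℝ)
    (V : Set (EuclideanSpace ℝ (Fin n))) : Prop :=
  (∃ K : NNReal, LipschitzOnWith K u V) ∧ ∃ M : ℝ, ∀ x ∈ V, |u x| ≤ M

/-- `u` is locally Lipschitz on `Ω`. -/
def LocLipschitzOn {n : ℕ} (u : EuclideanSpace ℝ (Fin n) → ℝ)
    (Ω : Set (EuclideanSpace ℝ (Fin n))) : Prop :=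
  ∀ x ∈ Ω, ∃ s ∈ nhds x, ∃ K : NNReal, LipschitzOnWith K u s

/-- The Dirichlet class `W_g^{1,∞}(Ω)`: bounded Lipschitz functions `u` on `Ω` such that
`u - g` extends continuously by zero to the boundary `∂Ω`. -/
def DirichletClass {n : ℕ} (Ω : Set (EuclideanSpace ℝ (Fin n)))
    (g u : EuclideanSpace ℝ (Fin n) → ℝ) : Prop :=
  BddLipschitzOn u Ω ∧
  ∀ x ∈ frontier Ω, Tendsto (fun y => u y - g y) (nhdsWithin x Ω) (nhds 0)

/-- `u ∈ A(g,Ω)`: `u` minimizes `F(·,Ω)` over `W_g^{1,∞}(Ω)`. -/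
def Minimizes {n : ℕ} (f : EuclideanSpace ℝ (Fin n) → ℝ → EuclideanSpace ℝ (Fin n) → ℝ)
    (Ω : Set (EuclideanSpace ℝ (Fin n))) (g u : EuclideanSpace ℝ (Fin n) → ℝ) : Prop :=
  DirichletClass Ω g u ∧ ∀ v, DirichletClass Ω g v → suprF f u Ω ≤ suprF f v Ω

/-- `u` is an absolute superminimizer of `F` on `Ω`. -/
def AbsSuper {n : ℕ} (f : EuclideanSpace ℝ (Fin n) → ℝ → EuclideanSpace ℝ (Fin n) → ℝ)
    (Ω : Set (EuclideanSpace ℝ (Fin n))) (u : EuclideanSpace ℝ (Fin n) → ℝ) : Prop :=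
  ∀ V : Set (EuclideanSpace ℝ (Fin n)), IsOpen V → IsCompact (closure V) → closure V ⊆ Ω →
    ∀ v : EuclideanSpace ℝ (Fin n) → ℝ,
      (∃ K : NNReal, LipschitzOnWith K v V) → ContinuousOn v (closure V) →
      (∀ x ∈ V, u x < v x) → (∀ x ∈ frontier V, v x = u x) →
      suprF f u V ≤ suprF f v V

/-- `u` is an absolute subminimizer of `F` on `Ω`. -/
def AbsSub {n : ℕ} (f : EuclideanSpace ℝ (Fin n) → ℝ → EuclideanSpace ℝ (Fin n) → ℝ)
    (Ω : Set (EuclideanSpace ℝ (Fin n))) (u : EuclideanSpace ℝ (Fin n) → ℝ) : Prop :=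
  ∀ V : Set (EuclideanSpace ℝ (Fin n)), IsOpen V → IsCompact (closure V) → closure V ⊆ Ω →
    ∀ v : EuclideanSpace ℝ (Fin n) → ℝ,
      (∃ K : NNReal, LipschitzOnWith K v V) → ContinuousOn v (closure V) →
      (∀ x ∈ V, v x < u x) → (∀ x ∈ frontier V, v x = u x) →
      suprF f u V ≤ suprF f v V

/-- `u` is an absolute minimizer of `F` on `Ω`: `F(v,V) ≥ F(u,V)` for every `V ⊂⊂ Ω` and every
`v ∈ W^{1,∞}(V) ∩ C(V̄)` with `v = u` on `∂V`. -/
def AbsMin {n : ℕ} (f : EuclideanSpace ℝ (Fin n) → ℝ → EuclideanSpace ℝ (Fin n) → ℝ)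
    (Ω : Set (EuclideanSpace ℝ (Fin n))) (u : EuclideanSpace ℝ (Fin n) → ℝ) : Prop :=
  ∀ V : Set (EuclideanSpace ℝ (Fin n)), IsOpen V → IsCompact (closure V) → closure V ⊆ Ω →
    ∀ v : EuclideanSpace ℝ (Fin n) → ℝ,
      (∃ K : NNReal, LipschitzOnWith K v V) → ContinuousOn v (closure V) →
      (∀ x ∈ frontier V, v x = u x) →
      suprF f u V ≤ suprF f v V

/-- If `w ≤ u` with equality at `x` and both are differentiable at `x`, the gradients agree. -/
lemma gradient_eq_of_le_of_eq {E : Type*} [NormedAddCommGroup E] [InnerProductSpace ℝ E]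
    [CompleteSpace E] {u w : E → ℝ} {x : E} (hu : DifferentiableAt ℝ u x)
    (hw : DifferentiableAt ℝ w x) (hle : ∀ y, w y ≤ u y) (hx : u x = w x) :
    gradient u x = gradient w x := by
  have hmin : IsLocalMin (u - w) x :=
    Filter.Eventually.of_forall fun y => by
      simpa [hx] using hle y
  have h0 := hmin.fderiv_eq_zero
  rw [fderiv_sub hu hw, sub_eq_zero] at h0
  simp only [gradient, h0]

/-- A function that is Lipschitz on an open set is differentiable at almost every point of it. -/
lemma LipschitzOnWith.ae_restrict_differentiableAt {n : ℕ}
    {Ω : Set (EuclideanSpace ℝ (Fin n))} (hΩ : IsOpen Ω) {K : NNReal}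
    {u : EuclideanSpace ℝ (Fin n) → ℝ} (hu : LipschitzOnWith K u Ω) :
    ∀ᵐ x ∂(volume.restrict Ω), DifferentiableAt ℝ u x := by
  rw [ae_restrict_iff' hΩ.measurableSet]
  filter_upwards [hu.ae_differentiableWithinAt_of_mem (μ := volume)] with x hx hxΩ
  exact (hx hxΩ).differentiableAt (hΩ.mem_nhds hxΩ)

lemma LipschitzOnWith.max_real {α : Type*} [PseudoMetricSpace α] {s : Set α} {K₁ K₂ : NNReal}
    {u₁ u₂ : α → ℝ} (h₁ : LipschitzOnWith K₁ u₁ s) (h₂ : LipschitzOnWith K₂ u₂ s) :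
    LipschitzOnWith (max K₁ K₂) (fun x => max (u₁ x) (u₂ x)) s := by
  rw [lipschitzOnWith_iff_restrict] at *
  exact LipschitzWith.max h₁ h₂

/-- Almost everywhere, the maximum of two Lipschitz functions agrees to first order with one
of them. -/
lemma ae_max_eq_and_gradient_eq {n : ℕ} {Ω : Set (EuclideanSpace ℝ (Fin n))} (hΩ : IsOpen Ω)
    {K₁ K₂ : NNReal} {u₁ u₂ : EuclideanSpace ℝ (Fin n) → ℝ}
    (h₁ : LipschitzOnWith K₁ u₁ Ω) (h₂ : LipschitzOnWith K₂ u₂ Ω) :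
    ∀ᵐ x ∂(volume.restrict Ω),
      (max (u₁ x) (u₂ x) = u₁ x ∧
        gradient (fun y => max (u₁ y) (u₂ y)) x = gradient u₁ x) ∨
      (max (u₁ x) (u₂ x) = u₂ x ∧
        gradient (fun y => max (u₁ y) (u₂ y)) x = gradient u₂ x) := by
  filter_upwards [h₁.ae_restrict_differentiableAt hΩ, h₂.ae_restrict_differentiableAt hΩ,
    (h₁.max_real h₂).ae_restrict_differentiableAt hΩ] with x hx₁ hx₂ hx
  rcases max_choice (u₁ x) (u₂ x) with h | h
  · exact .inl ⟨h, gradient_eq_of_le_of_eq hx hx₁ (fun y => le_max_left _ _) h⟩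
  · exact .inr ⟨h, gradient_eq_of_le_of_eq hx hx₂ (fun y => le_max_right _ _) h⟩

lemma ae_le_suprF {n : ℕ}
    (f : EuclideanSpace ℝ (Fin n) → ℝ → EuclideanSpace ℝ (Fin n) → ℝ)
    (u : EuclideanSpace ℝ (Fin n) → ℝ) (V : Set (EuclideanSpace ℝ (Fin n))) :
    ∀ᵐ x ∂(volume.restrict V), ((f x (u x) (gradient u x) : ℝ) : EReal) ≤ suprF f u V :=
  ae_le_essSup

lemma suprF_mono_set {n : ℕ}
    (f : EuclideanSpace ℝ (Fin n) → ℝ → EuclideanSpace ℝ (Fin n) → ℝ)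
    (u : EuclideanSpace ℝ (Fin n) → ℝ) {V W : Set (EuclideanSpace ℝ (Fin n))} (h : V ⊆ W) :
    suprF f u V ≤ suprF f u W :=
  essSup_mono_measure (Measure.restrict_mono h le_rfl).absolutelyContinuous

lemma DirichletClass.max {n : ℕ} {Ω : Set (EuclideanSpace ℝ (Fin n))}
    {g u₁ u₂ : EuclideanSpace ℝ (Fin n) → ℝ} (h₁ : DirichletClass Ω g u₁)
    (h₂ : DirichletClass Ω g u₂) : DirichletClass Ω g (fun x => max (u₁ x) (u₂ x)) := by
  obtain ⟨⟨⟨K₁, hK₁⟩, M₁, hM₁⟩, hb₁⟩ := h₁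
  obtain ⟨⟨⟨K₂, hK₂⟩, M₂, hM₂⟩, hb₂⟩ := h₂
  refine ⟨⟨⟨_, hK₁.max_real hK₂⟩, Max.max M₁ M₂, fun x hx => ?_⟩, fun x hx => ?_⟩
  · exact abs_max_le_max_abs_abs.trans (max_le_max (hM₁ x hx) (hM₂ x hx))
  · simpa [max_sub_sub_right] using (hb₁ x hx).max (hb₂ x hx)

lemma isOpen_sep_lt {X : Type*} [TopologicalSpace X] {V : Set X} (hV : IsOpen V)
    {u v : X → ℝ} (hu : ContinuousOn u V) (hv : ContinuousOn v V) :
    IsOpen {x ∈ V | v x < u x} := by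
  have h := (hu.sub hv).isOpen_inter_preimage hV isOpen_Ioi (t := Ioi 0)
  convert h using 1
  ext x
  simp

/-- On the part of `V` where the competitor `v` of a larger function `w` lies below the absolute
subminimizer `u ≤ w`, `v` is a competitor of `u`. -/
lemma AbsSub.suprF_sep_lt_le {n : ℕ}
    {f : EuclideanSpace ℝ (Fin n) → ℝ → EuclideanSpace ℝ (Fin n) → ℝ}
    {Ω V : Set (EuclideanSpace ℝ (Fin n))} {u w v : EuclideanSpace ℝ (Fin n) → ℝ}
    (hsub : AbsSub f Ω u) (hu : ContinuousOn u Ω) (huw : ∀ x, u x ≤ w x)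
    (hV : IsOpen V) (hVc : IsCompact (closure V)) (hVΩ : closure V ⊆ Ω)
    (hvL : ∃ K : NNReal, LipschitzOnWith K v V) (hvc : ContinuousOn v (closure V))
    (hvw : ∀ x ∈ frontier V, v x = w x) :
    suprF f u {x ∈ V | v x < u x} ≤ suprF f v V := by
  have hsV : {x ∈ V | v x < u x} ⊆ V := sep_subset _ _
  have hcl := closure_mono hsV
  have huc := hu.mono hVΩ
  have hopen := isOpen_sep_lt hV (huc.mono subset_closure) (hvc.mono subset_closure)
  refine (hsub _ hopen (hVc.of_isClosed_subset isClosed_closure hcl) (hcl.trans hVΩ) v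
    (hvL.imp fun K hK => hK.mono hsV) (hvc.mono hcl) (fun x hx => hx.2) fun x hx => ?_).trans
    (suprF_mono_set f v hsV)
  have hxc : x ∈ closure {x ∈ V | v x < u x} := hx.1
  have hle : v x ≤ u x :=
    ContinuousWithinAt.closure_le hxc ((hvc x (hcl hxc)).mono (hsV.trans subset_closure))
      ((huc x (hcl hxc)).mono (hsV.trans subset_closure)) fun y hy => hy.2.le
  refine hle.antisymm ?_
  by_cases hxV : x ∈ V
  · rw [hopen.frontier_eq] at hx
    exact not_lt.1 fun h => hx.2 ⟨hxV, h⟩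
  · exact (huw x).trans_eq (hvw x (by rw [hV.frontier_eq]; exact ⟨hcl hxc, hxV⟩)).symm

/-- Lemma 3.1(i): if `u₁, u₂ ∈ A_sub(g,Ω)` then `max(u₁,u₂) ∈ A_sub(g,Ω)`. -/
theorem stmt5 {n : ℕ} (Ω : Set (EuclideanSpace ℝ (Fin n)))
    (hΩo : IsOpen Ω) (hΩb : Bornology.IsBounded Ω)
    (f : EuclideanSpace ℝ (Fin n) → ℝ → EuclideanSpace ℝ (Fin n) → ℝ)
    (hfm : Measurable (fun q : EuclideanSpace ℝ (Fin n) × ℝ × EuclideanSpace ℝ (Fin n) =>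
      f q.1 q.2.1 q.2.2))
    (g : EuclideanSpace ℝ (Fin n) → ℝ) (hg : BddLipschitzOn g Ω)
    (u₁ u₂ : EuclideanSpace ℝ (Fin n) → ℝ)
    (h₁ : Minimizes f Ω g u₁ ∧ AbsSub f Ω u₁)
    (h₂ : Minimizes f Ω g u₂ ∧ AbsSub f Ω u₂) :
    Minimizes f Ω g (fun x => max (u₁ x) (u₂ x)) ∧
      AbsSub f Ω (fun x => max (u₁ x) (u₂ x)) := by
  have hd := h₁.1.1.max h₂.1.1
  obtain ⟨K₁, hK₁⟩ := h₁.1.1.1.1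
  obtain ⟨K₂, hK₂⟩ := h₂.1.1.1.1
  refine ⟨⟨hd, fun v hv => ?_⟩, fun V hV hVc hVΩ v hvL hvc hvlt hveq => ?_⟩
  · refine essSup_le_of_ae_le _ ?_
    filter_upwards [ae_max_eq_and_gradient_eq hΩo hK₁ hK₂, ae_le_suprF f u₁ Ω,
      ae_le_suprF f u₂ Ω] with x hx hx₁ hx₂
    rcases hx with ⟨h, h'⟩ | ⟨h, h'⟩
    · rw [h, h']
      exact hx₁.trans (h₁.1.2 v hv)
    · rw [h, h']
      exact hx₂.trans (h₂.1.2 v hv)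
  · have hVΩ' : V ⊆ Ω := subset_closure.trans hVΩ
    have hF₁ := h₁.2.suprF_sep_lt_le hK₁.continuousOn (fun x => le_max_left (u₁ x) (u₂ x))
      hV hVc hVΩ hvL hvc hveq
    have hF₂ := h₂.2.suprF_sep_lt_le hK₂.continuousOn (fun x => le_max_right (u₁ x) (u₂ x))
      hV hVc hVΩ hvL hvc hveq
    have ho₁ := isOpen_sep_lt hV (hK₁.continuousOn.mono hVΩ') (hvc.mono subset_closure)
    have ho₂ := isOpen_sep_lt hV (hK₂.continuousOn.mono hVΩ') (hvc.mono subset_closure)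
    have hae₁ := ae_le_suprF f u₁ {x ∈ V | v x < u₁ x}
    have hae₂ := ae_le_suprF f u₂ {x ∈ V | v x < u₂ x}
    rw [ae_restrict_iff' ho₁.measurableSet] at hae₁
    rw [ae_restrict_iff' ho₂.measurableSet] at hae₂
    refine essSup_le_of_ae_le _ ?_
    filter_upwards [ae_max_eq_and_gradient_eq hV (hK₁.mono hVΩ') (hK₂.mono hVΩ'),
      ae_restrict_of_ae hae₁, ae_restrict_of_ae hae₂, ae_restrict_mem hV.measurableSet]
      with x hx hx₁ hx₂ hxV
    have hlt : v x < max (u₁ x) (u₂ x) := hvlt x hxV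
    rcases hx with ⟨h, h'⟩ | ⟨h, h'⟩
    · rw [h] at hlt
      rw [h, h']
      exact (hx₁ ⟨hxV, hlt⟩).trans hF₁
    · rw [h] at hlt
      rw [h, h']
      exact (hx₂ ⟨hxV, hlt⟩).trans hF₂
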